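/- arXiv:2604.03991 — 2 statements merged into one kernel-verified Lean document; each statement's English description precedes it below -/
import Mathlib

section
/- Let A and B be commutative rings and let φ : A → B be a surjective ring homomorphism whose kernel is the principal ideal ⟨π⟩ for some π ∈ A. If I is an ideal of A such that the ideal φ(I) of B is generated by n elements, then there exist a₁, a₂, …, aₙ ∈ I such that I = ⟨a₁, a₂, …, aₙ⟩ + π·(I : π). -/
theorem stmt_0 {A B : Type*} [CommRing A] [CommRing B] (φ : A →+* B)
    (hφ : Function.Surjective φ) (π : A) (hker : RingHom.ker φ = Ideal.span {π})
    (I : Ideal A) (n : ℕ) (b : Fin n → B)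
    (hgen : Ideal.map φ I = Ideal.span (Set.range b)) :
    ∃ a : Fin n → A, (∀ i, a i ∈ I) ∧
      I = Ideal.span (Set.range a) +
        Ideal.span {π} * Submodule.colon I (Ideal.span {π}) := by
  have hb : ∀ i, ∃ x ∈ I, φ x = b i := fun i =>
    (Ideal.mem_map_iff_of_surjective φ hφ).1
      (hgen ▸ Ideal.subset_span (Set.mem_range_self i))
  choose a haI hab using hb
  have hspan : Ideal.span (Set.range a) ≤ I :=
    Ideal.span_le.2 (Set.range_subset_iff.2 haI)
  have hmap : Ideal.map φ (Ideal.span (Set.range a)) = Ideal.map φ I := by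
    rw [hgen, Ideal.map_span, ← Set.range_comp]
    congr 2
    exact funext hab
  refine ⟨a, haI, le_antisymm (fun x hx => ?_) (sup_le hspan (Ideal.mul_le.2 ?_))⟩
  · have hφx : φ x ∈ Ideal.map φ (Ideal.span (Set.range a)) :=
      hmap ▸ Ideal.mem_map_of_mem φ hx
    obtain ⟨y, hy, hyx⟩ := (Ideal.mem_map_iff_of_surjective φ hφ).1 hφx
    have hxy : x - y ∈ Ideal.span {π} := by
      rw [← hker, RingHom.mem_ker, map_sub, hyx, sub_self]
    obtain ⟨c, hc⟩ := Ideal.mem_span_singleton'.1 hxy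
    have hcI : c * π ∈ I := hc ▸ I.sub_mem hx (hspan hy)
    refine Submodule.mem_sup.2 ⟨y, hy, π * c, Ideal.mul_mem_mul
      (Ideal.mem_span_singleton_self π) (Submodule.mem_colon.2 fun p hp => ?_), ?_⟩
    · obtain ⟨d, rfl⟩ := Ideal.mem_span_singleton'.1 hp
      rw [smul_eq_mul, mul_left_comm]
      exact I.mul_mem_left d hcI
    · rw [mul_comm, hc, add_sub_cancel]
  · intro p hp c hc
    rw [mul_comm]
    exact Submodule.mem_colon.1 hc p hp
end

section
/- Let A and B be commutative rings and let φ : A → B be a surjective ring homomorphism whose kernel is the principal ideal ⟨π⟩. If B is a principal ideal ring, then for every ideal I of A there exists a ∈ I such that I = ⟨a⟩ + π·(I : π). -/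
theorem stmt_1 {A B : Type*} [CommRing A] [CommRing B] [IsPrincipalIdealRing B]
    (φ : A →+* B) (hφ : Function.Surjective φ) (π : A)
    (hker : RingHom.ker φ = Ideal.span {π}) (I : Ideal A) :
    ∃ a ∈ I, I = Ideal.span {a} +
      Ideal.span {π} * Submodule.colon I (Ideal.span {π}) := by
  obtain ⟨b, hb⟩ := (IsPrincipalIdealRing.principal (I.map φ)).principal
  have hbI : b ∈ I.map φ := hb ▸ Submodule.mem_span_singleton_self b
  obtain ⟨a, ha, rfl⟩ := (Ideal.mem_map_iff_of_surjective φ hφ).1 hbI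
  refine ⟨a, ha, le_antisymm (fun x hx => ?_) (sup_le ?_ ?_)⟩
  · have hx' : φ x ∈ Ideal.span {φ a} := by
      have h := Ideal.mem_map_of_mem φ hx
      rwa [hb] at h
    obtain ⟨s, hs⟩ := Ideal.mem_span_singleton'.1 hx'
    obtain ⟨r, rfl⟩ := hφ s
    have hk : x - r * a ∈ Ideal.span {π} := by
      rw [← hker, RingHom.mem_ker, map_sub, map_mul, hs, sub_self]
    obtain ⟨c, hc⟩ := Ideal.mem_span_singleton'.1 hk
    have hcI : c * π ∈ I := hc ▸ I.sub_mem hx (I.mul_mem_left r ha)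
    have hcolon : c ∈ Submodule.colon I (Ideal.span {π} : Set A) := by
      refine Submodule.mem_colon.2 fun y hy => ?_
      obtain ⟨d, rfl⟩ := Ideal.mem_span_singleton'.1 hy
      simpa [mul_left_comm] using I.mul_mem_left d hcI
    have hx_eq : x = r * a + π * c := by linear_combination -hc
    rw [hx_eq]
    exact Submodule.add_mem_sup (Ideal.mem_span_singleton'.2 ⟨r, rfl⟩)
      (Ideal.mul_mem_mul (Ideal.mem_span_singleton_self π) hcolon)
  · exact (Ideal.span_singleton_le_iff_mem I).2 ha
  · refine Ideal.mul_le.2 fun y hy c hc => ?_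
    simpa [mul_comm] using Submodule.mem_colon.1 hc y hy
end
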